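/- Let V : Ω → [0,∞) be measurable and integrable on bounded subsets of Ω. Let u ∈ 𝓗⁰ satisfy ∫_Ω V|u|² dxdy < ∞ and ∫_Ω V|Pu|² dxdy < ∞, and write v = Pu, w = u − Pu. Then ∫_Ω(|∇u|² − (π²/(4d²))|u|²) dxdy − ∫_Ω V|u|² dxdy ≥ [ ∫_Ω(|∇v|² − (π²/(4d²))|v|²) dxdy − 2∫_Ω V|v|² dxdy ] + [ ∫_Ω(|∇w|² − (π²/(4d²))|w|²) dxdy − 2∫_Ω V|w|² dxdy ]. -/

import Mathlib

open Real MeasureTheory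

/-- The strip `Ω = ℝ × (0,d)`. -/
def Strip (d : ℝ) : Set (ℝ × ℝ) := Set.univ ×ˢ Set.Ioo 0 d

/-- The space `𝓗⁰`: continuously differentiable functions `u : ℝ² → ℂ` with
`u(x,0) = 0`, `(∂u/∂y)(x,d) = 0`, such that `u`, `∂u/∂x`, `∂u/∂y` are square
integrable over `Ω`. -/
def InH0 (d : ℝ) (u : ℝ × ℝ → ℂ) : Prop :=
  ContDiff ℝ 1 u ∧ (∀ x : ℝ, u (x, 0) = 0) ∧
    (∀ x : ℝ, fderiv ℝ u (x, d) (0, 1) = 0) ∧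
    IntegrableOn (fun p => ‖u p‖ ^ 2) (Strip d) ∧
    IntegrableOn (fun p => ‖fderiv ℝ u p (1, 0)‖ ^ 2) (Strip d) ∧
    IntegrableOn (fun p => ‖fderiv ℝ u p (0, 1)‖ ^ 2) (Strip d)

/-- The projection `(Pu)(x,y) = h_u(x)·sin(πy/(2d))`,
`h_u(x) = (2/d)∫₀^d u(x,t)·sin(πt/(2d)) dt`. -/
noncomputable def Pmap (d : ℝ) (u : ℝ × ℝ → ℂ) : ℝ × ℝ → ℂ := fun p =>
  ((2 / d : ℝ) * ∫ t in (0:ℝ)..d, u (p.1, t) * (Real.sin (π * t / (2 * d)) : ℂ)) *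
    (Real.sin (π * p.2 / (2 * d)) : ℂ)

/-- The shifted quadratic form with potential `V` and coupling `c ≥ 1`:
`∫_Ω (|∇u|² − (π²/(4d²))|u|²) − c ∫_Ω V|u|²`. -/
noncomputable def qV (d : ℝ) (V : ℝ × ℝ → ℝ) (c : ℝ) (u : ℝ × ℝ → ℂ) : ℝ :=
  (∫ p in Strip d,
      ((‖fderiv ℝ u p (1, 0)‖ ^ 2 + ‖fderiv ℝ u p (0, 1)‖ ^ 2) -
        (π ^ 2 / (4 * d ^ 2)) * ‖u p‖ ^ 2)) -
    c * ∫ p in Strip d, V p * ‖u p‖ ^ 2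


/-- The coefficient of a slice against `ψ`. -/
noncomputable def hcoef (d : ℝ) (F : ℝ × ℝ → ℂ) (ψ : ℝ → ℝ) (x : ℝ) : ℂ :=
  ((2 / d : ℝ) : ℂ) * ∫ t in (0:ℝ)..d, F (x, t) * (ψ t : ℂ)

theorem hcoef_continuous (d : ℝ) (F : ℝ × ℝ → ℂ) (ψ : ℝ → ℝ) (hF : Continuous F)
    (hψ : Continuous ψ) : Continuous (hcoef d F ψ) := by
  unfold hcoef
  refine continuous_const.mul ?_
  apply intervalIntegral.continuous_parametric_intervalIntegral_of_continuous'
  simp only [Function.uncurry_def]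
  fun_prop

theorem norm_sub_sq_slice (a H : ℂ) (s : ℝ) :
    ‖a - H * (s : ℂ)‖ ^ 2 = ‖a‖ ^ 2 - 2 * (H.re * (a.re * s) + H.im * (a.im * s))
      + ‖H‖ ^ 2 * s ^ 2 := by
  simp only [Complex.sq_norm, Complex.normSq_apply, Complex.sub_re, Complex.sub_im,
    Complex.mul_re, Complex.mul_im, Complex.ofReal_re, Complex.ofReal_im]
  ring

theorem slice_identity (d : ℝ) (hd : 0 < d) (f : ℝ → ℂ) (ψ : ℝ → ℝ) (hf : Continuous f)
    (hψ : Continuous ψ) (hn : ∫ t in (0:ℝ)..d, ψ t ^ 2 = d / 2) (H : ℂ)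
    (hH : H = ((2 / d : ℝ) : ℂ) * ∫ t in (0:ℝ)..d, f t * (ψ t : ℂ)) :
    ∫ t in (0:ℝ)..d, ‖f t - H * (ψ t : ℂ)‖ ^ 2
      = (∫ t in (0:ℝ)..d, ‖f t‖ ^ 2) - ‖H‖ ^ 2 * (d / 2) := by
  have hI : ∫ t in (0:ℝ)..d, f t * (ψ t : ℂ) = ((d / 2 : ℝ) : ℂ) * H := by
    rw [hH, ← mul_assoc, ← Complex.ofReal_mul]
    have : d / 2 * (2 / d) = 1 := by field_simp
    rw [this]; simp
  have hii : IntervalIntegrable (fun t => f t * (ψ t : ℂ)) volume 0 d :=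
    Continuous.intervalIntegrable (by fun_prop) _ _
  have hre : ∫ t in (0:ℝ)..d, (f t).re * ψ t = d / 2 * H.re := by
    have := Complex.reCLM.intervalIntegral_comp_comm hii
    rw [hI] at this
    simpa using this
  have him : ∫ t in (0:ℝ)..d, (f t).im * ψ t = d / 2 * H.im := by
    have := Complex.imCLM.intervalIntegral_comp_comm hii
    rw [hI] at this
    simpa using this
  have c1 : Continuous fun t => (f t).re := Complex.continuous_re.comp hf
  have c2 : Continuous fun t => (f t).im := Complex.continuous_im.comp hf
  simp_rw [norm_sub_sq_slice]
  rw [intervalIntegral.integral_add, intervalIntegral.integral_sub,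
    intervalIntegral.integral_const_mul, intervalIntegral.integral_add,
    intervalIntegral.integral_const_mul, intervalIntegral.integral_const_mul,
    intervalIntegral.integral_const_mul, hre, him, hn]
  · have : ‖H‖ ^ 2 = H.re * H.re + H.im * H.im := by
      rw [Complex.sq_norm, Complex.normSq_apply]
    rw [this]; ring
  all_goals exact Continuous.intervalIntegrable (by fun_prop) _ _

theorem strip_restrict (d : ℝ) : (volume : Measure (ℝ × ℝ)).restrict (Strip d)
    = (volume : Measure ℝ).prod ((volume : Measure ℝ).restrict (Set.Ioo 0 d)) := by
  unfold Strip
  rw [Measure.volume_eq_prod, ← Measure.prod_restrict, Measure.restrict_univ]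

theorem Ioo_eq_interval (d : ℝ) (hd : 0 < d) (g : ℝ → ℝ) :
    ∫ t in Set.Ioo 0 d, g t = ∫ t in (0:ℝ)..d, g t := by
  rw [intervalIntegral.integral_of_le hd.le, integral_Ioc_eq_integral_Ioo]

theorem integrableOn_sub_sq {S : Set (ℝ × ℝ)} (W : ℝ × ℝ → ℝ) (hW : Measurable W)
    (hW0 : ∀ p, 0 ≤ W p) (F G : ℝ × ℝ → ℂ)
    (hF : Continuous F) (hG : Continuous G) (h1 : IntegrableOn (fun p => W p * ‖F p‖ ^ 2) S)
    (h2 : IntegrableOn (fun p => W p * ‖G p‖ ^ 2) S) :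
    IntegrableOn (fun p => W p * ‖F p - G p‖ ^ 2) S := by
  refine Integrable.mono' ((h1.const_mul 2).add (h2.const_mul 2)) ?_ ?_
  · exact (hW.mul (by fun_prop)).aestronglyMeasurable
  · refine Filter.Eventually.of_forall fun p => ?_
    have h := norm_sub_le (F p) (G p)
    have h3 : ‖F p - G p‖ ^ 2 ≤ 2 * ‖F p‖ ^ 2 + 2 * ‖G p‖ ^ 2 := by
      nlinarith [sq_nonneg (‖F p‖ - ‖G p‖), norm_nonneg (F p - G p), norm_nonneg (F p),
        norm_nonneg (G p)]
    have h4 := hW0 p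
    rw [Real.norm_of_nonneg (by positivity)]
    have := mul_le_mul_of_nonneg_left h3 h4
    simp only [Pi.add_apply]
    linarith

theorem proj_lemma (d : ℝ) (hd : 0 < d) (F : ℝ × ℝ → ℂ) (ψ : ℝ → ℝ) (hF : Continuous F)
    (hψ : Continuous ψ) (hn : ∫ t in (0:ℝ)..d, ψ t ^ 2 = d / 2)
    (hint : IntegrableOn (fun p => ‖F p‖ ^ 2) (Strip d)) :
    IntegrableOn (fun p => ‖hcoef d F ψ p.1 * (ψ p.2 : ℂ)‖ ^ 2) (Strip d) ∧
    IntegrableOn (fun p => ‖F p - hcoef d F ψ p.1 * (ψ p.2 : ℂ)‖ ^ 2) (Strip d) ∧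
    ∫ p in Strip d, ‖F p‖ ^ 2 = (∫ p in Strip d, ‖hcoef d F ψ p.1 * (ψ p.2 : ℂ)‖ ^ 2) +
      ∫ p in Strip d, ‖F p - hcoef d F ψ p.1 * (ψ p.2 : ℂ)‖ ^ 2 := by
  have hHc := hcoef_continuous d F ψ hF hψ
  have hsl : ∀ x, ∫ t in (0:ℝ)..d, ‖F (x, t) - hcoef d F ψ x * (ψ t : ℂ)‖ ^ 2
      = (∫ t in (0:ℝ)..d, ‖F (x, t)‖ ^ 2) - ‖hcoef d F ψ x‖ ^ 2 * (d / 2) := fun x =>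
    slice_identity d hd (fun t => F (x, t)) ψ (by fun_prop) hψ hn _ rfl
  have hint' : Integrable (fun p => ‖F p‖ ^ 2)
      ((volume : Measure ℝ).prod ((volume : Measure ℝ).restrict (Set.Ioo 0 d))) := by
    rw [← strip_restrict]; exact hint
  have hS := hint'.integral_prod_left
  simp only [Ioo_eq_interval d hd] at hS
  have hH2 : Integrable (fun x => ‖hcoef d F ψ x‖ ^ 2) := by
    refine Integrable.mono' (hS.const_mul (2 / d)) (by fun_prop) ?_
    refine Filter.Eventually.of_forall fun x => ?_
    have h0 : 0 ≤ ∫ t in (0:ℝ)..d, ‖F (x, t) - hcoef d F ψ x * (ψ t : ℂ)‖ ^ 2 :=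
      intervalIntegral.integral_nonneg hd.le fun t _ => by positivity
    rw [hsl x] at h0
    rw [Real.norm_of_nonneg (by positivity), div_mul_eq_mul_div, le_div_iff₀ hd]
    linarith
  have hψ2 : Integrable (fun t => ψ t ^ 2) ((volume : Measure ℝ).restrict (Set.Ioo 0 d)) :=
    ((hψ.pow 2).integrableOn_Icc (a := 0) (b := d)).mono_set Set.Ioo_subset_Icc_self
  have hG : IntegrableOn (fun p : ℝ × ℝ => ‖hcoef d F ψ p.1 * (ψ p.2 : ℂ)‖ ^ 2) (Strip d) := by
    unfold IntegrableOn
    rw [strip_restrict]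
    refine (hH2.mul_prod hψ2).congr (Filter.Eventually.of_forall fun p => ?_)
    simp [mul_pow]
  have hW : IntegrableOn (fun p => ‖F p - hcoef d F ψ p.1 * (ψ p.2 : ℂ)‖ ^ 2) (Strip d) := by
    have := integrableOn_sub_sq (S := Strip d) (fun _ => 1) measurable_const
      (fun _ => zero_le_one) F (fun p => hcoef d F ψ p.1 * (ψ p.2 : ℂ)) hF (by fun_prop)
      (by simpa using hint) (by simpa using hG)
    simpa using this
  refine ⟨hG, hW, ?_⟩
  rw [← integral_add hG hW]
  have hGW : IntegrableOn (fun p => ‖hcoef d F ψ p.1 * (ψ p.2 : ℂ)‖ ^ 2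
      + ‖F p - hcoef d F ψ p.1 * (ψ p.2 : ℂ)‖ ^ 2) (Strip d) := hG.add hW
  unfold IntegrableOn at hGW
  rw [strip_restrict] at hGW ⊢
  rw [integral_prod _ hint', integral_prod _ hGW]
  congr 1
  ext x
  simp only [Ioo_eq_interval d hd]
  rw [intervalIntegral.integral_add, hsl x]
  · simp only [norm_mul, mul_pow, Complex.norm_real, Real.norm_eq_abs, sq_abs]
    rw [intervalIntegral.integral_const_mul, hn]; ring
  all_goals exact Continuous.intervalIntegrable (by fun_prop) _ _

theorem hcoef_hasDerivAt (d : ℝ) (u : ℝ × ℝ → ℂ) (ψ : ℝ → ℝ) (hu : ContDiff ℝ 1 u)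
    (hψ : Continuous ψ) (x : ℝ) :
    HasDerivAt (hcoef d u ψ) (hcoef d (fun p => fderiv ℝ u p (1, 0)) ψ x) x := by
  have hc : Continuous u := hu.continuous
  have hc' : Continuous (fun p => fderiv ℝ u p (1, 0)) :=
    (hu.continuous_fderiv (by norm_num)).clm_apply continuous_const
  unfold hcoef
  refine HasDerivAt.const_mul _ ?_
  have hK : IsCompact ((Set.Icc (x - 1) (x + 1)) ×ˢ (Set.uIcc 0 d)) :=
    isCompact_Icc.prod isCompact_uIcc
  have hcc : Continuous (fun p : ℝ × ℝ => fderiv ℝ u p (1, 0) * (ψ p.2 : ℂ)) := by fun_prop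
  obtain ⟨C, hC⟩ := hK.exists_bound_of_continuousOn hcc.continuousOn
  refine (intervalIntegral.hasDerivAt_integral_of_dominated_loc_of_deriv_le
    (F := fun x t => u (x, t) * (ψ t : ℂ))
    (F' := fun x t => fderiv ℝ u (x, t) (1, 0) * (ψ t : ℂ))
    (s := Set.Icc (x - 1) (x + 1)) (bound := fun _ => C)
    (Icc_mem_nhds (by linarith) (by linarith)) ?_ ?_ ?_ ?_ ?_ ?_).2
  · refine Filter.Eventually.of_forall fun y => ?_
    exact Continuous.aestronglyMeasurable (by fun_prop)
  · exact Continuous.intervalIntegrable (by fun_prop) _ _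
  · exact Continuous.aestronglyMeasurable
      (hcc.comp (by fun_prop : Continuous fun t : ℝ => (x, t)))
  · refine Filter.Eventually.of_forall fun t ht y hy => ?_
    exact hC (y, t) ⟨hy, Set.uIoc_subset_uIcc ht⟩
  · exact intervalIntegrable_const
  · refine Filter.Eventually.of_forall fun t ht y hy => ?_
    refine HasDerivAt.mul_const ?_ _
    have h1 : HasFDerivAt u (fderiv ℝ u (y, t)) (y, t) :=
      (hu.differentiable (by norm_num) _).hasFDerivAt
    have h2 : HasDerivAt (fun z : ℝ => (z, t)) ((1 : ℝ), (0 : ℝ)) y :=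
      (hasDerivAt_id y).prodMk (hasDerivAt_const y t)
    exact h1.comp_hasDerivAt y h2

theorem sin_hasDerivAt (d y : ℝ) : HasDerivAt (fun t : ℝ => Real.sin (π * t / (2 * d)))
    (π / (2 * d) * Real.cos (π * y / (2 * d))) y := by
  have h : HasDerivAt (fun t : ℝ => π * t / (2 * d)) (π / (2 * d)) y := by
    simpa using ((hasDerivAt_id y).const_mul π).div_const (2 * d)
  simpa [mul_comm] using h.sin

theorem cos_hasDerivAt (d y : ℝ) : HasDerivAt (fun t : ℝ => Real.cos (π * t / (2 * d)))
    (-(π / (2 * d)) * Real.sin (π * y / (2 * d))) y := by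
  have h : HasDerivAt (fun t : ℝ => π * t / (2 * d)) (π / (2 * d)) y := by
    simpa using ((hasDerivAt_id y).const_mul π).div_const (2 * d)
  simpa [mul_comm] using h.cos

theorem arg_d (d : ℝ) (hd : 0 < d) : π * d / (2 * d) = π / 2 := by field_simp

theorem sin_sq_int (d : ℝ) (hd : 0 < d) :
    ∫ t in (0:ℝ)..d, Real.sin (π * t / (2 * d)) ^ 2 = d / 2 := by
  have hpi := Real.pi_pos
  have h := intervalIntegral.integral_eq_sub_of_hasDerivAt (a := 0) (b := d)
    (f := fun t => t / 2 - d / π * (Real.sin (π * t / (2 * d)) * Real.cos (π * t / (2 * d))))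
    (f' := fun t => Real.sin (π * t / (2 * d)) ^ 2) ?_
    (Continuous.intervalIntegrable (by fun_prop) _ _)
  · rw [h]; simp [arg_d d hd]
  · intro t _
    have := ((hasDerivAt_id t).div_const 2).sub
      (((sin_hasDerivAt d t).mul (cos_hasDerivAt d t)).const_mul (d / π))
    refine HasDerivAt.congr_deriv this ?_
    have e : d / π * (π / (2 * d)) = 1 / 2 := by field_simp
    have := Real.sin_sq_add_cos_sq (π * t / (2 * d))
    linear_combination -(1 / 2) * this - (Real.cos (π * t / (2 * d)) ^ 2
      - Real.sin (π * t / (2 * d)) ^ 2) * e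

theorem cos_sq_int (d : ℝ) (hd : 0 < d) :
    ∫ t in (0:ℝ)..d, Real.cos (π * t / (2 * d)) ^ 2 = d / 2 := by
  simp_rw [Real.cos_sq']
  rw [intervalIntegral.integral_sub, sin_sq_int d hd]
  · simp; ring
  all_goals exact Continuous.intervalIntegrable (by fun_prop) _ _

theorem hcoef_dy (d : ℝ) (hd : 0 < d) (u : ℝ × ℝ → ℂ) (hu : ContDiff ℝ 1 u)
    (h0 : ∀ x, u (x, 0) = 0) (x : ℝ) :
    hcoef d (fun p => fderiv ℝ u p (0, 1)) (fun t => Real.cos (π * t / (2 * d))) x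
      = ((π / (2 * d) : ℝ) : ℂ) * hcoef d u (fun t => Real.sin (π * t / (2 * d))) x := by
  have hc : Continuous u := hu.continuous
  have hc' : Continuous (fun p => fderiv ℝ u p (0, 1)) :=
    (hu.continuous_fderiv (by norm_num)).clm_apply continuous_const
  have hct : Continuous (fun t : ℝ => fderiv ℝ u (x, t) (0, 1)) :=
    hc'.comp (by fun_prop : Continuous fun t : ℝ => (x, t))
  unfold hcoef
  rw [← mul_assoc, mul_comm (((π / (2 * d) : ℝ)) : ℂ), mul_assoc]
  congr 1
  have h := intervalIntegral.integral_eq_sub_of_hasDerivAt (a := 0) (b := d)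
    (f := fun t => u (x, t) * ((Real.cos (π * t / (2 * d)) : ℝ) : ℂ))
    (f' := fun t => fderiv ℝ u (x, t) (0, 1) * ((Real.cos (π * t / (2 * d)) : ℝ) : ℂ)
      + u (x, t) * ((-(π / (2 * d)) * Real.sin (π * t / (2 * d)) : ℝ) : ℂ)) ?_
    (Continuous.intervalIntegrable (by fun_prop) _ _)
  · rw [intervalIntegral.integral_add (Continuous.intervalIntegrable (by fun_prop) _ _)
      (Continuous.intervalIntegrable (by fun_prop) _ _)] at h
    have e : ∀ t : ℝ, u (x, t) * ((-(π / (2 * d)) * Real.sin (π * t / (2 * d)) : ℝ) : ℂ)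
        = -((π / (2 * d) : ℝ) : ℂ) * (u (x, t) * ((Real.sin (π * t / (2 * d)) : ℝ) : ℂ)) := by
      intro t; push_cast; ring
    simp_rw [e] at h
    rw [intervalIntegral.integral_const_mul, h0 x, arg_d d hd, Real.cos_pi_div_two] at h
    simp only [Complex.ofReal_zero, mul_zero, zero_mul, sub_zero] at h
    linear_combination h
  · intro t _
    have h1 : HasFDerivAt u (fderiv ℝ u (x, t)) (x, t) :=
      (hu.differentiable (by norm_num) _).hasFDerivAt
    have h2 : HasDerivAt (fun z : ℝ => (x, z)) ((0 : ℝ), (1 : ℝ)) t :=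
      (hasDerivAt_const t x).prodMk (hasDerivAt_id t)
    exact (h1.comp_hasDerivAt t h2).mul (cos_hasDerivAt d t).ofReal_comp

theorem integral_three {S : Set (ℝ × ℝ)} (f g k : ℝ × ℝ → ℝ) (c : ℝ) (hf : IntegrableOn f S)
    (hg : IntegrableOn g S) (hk : IntegrableOn k S) :
    ∫ p in S, ((f p + g p) - c * k p)
      = (∫ p in S, f p) + (∫ p in S, g p) - c * ∫ p in S, k p := by
  have hfg : IntegrableOn (fun p => f p + g p) S := hf.add hg
  rw [integral_sub hfg (hk.const_mul c), integral_add hf hg, integral_const_mul]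

theorem Pmap_eq (d : ℝ) (u : ℝ × ℝ → ℂ) : Pmap d u = fun p =>
    hcoef d u (fun t => Real.sin (π * t / (2 * d))) p.1 *
      ((Real.sin (π * p.2 / (2 * d)) : ℝ) : ℂ) := rfl

theorem Pmap_hasFDerivAt (d : ℝ) (u : ℝ × ℝ → ℂ) (hu : ContDiff ℝ 1 u) (p : ℝ × ℝ) :
    DifferentiableAt ℝ (Pmap d u) p ∧
    fderiv ℝ (Pmap d u) p (1, 0) =
      hcoef d (fun p => fderiv ℝ u p (1, 0)) (fun t => Real.sin (π * t / (2 * d))) p.1 *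
        ((Real.sin (π * p.2 / (2 * d)) : ℝ) : ℂ) ∧
    fderiv ℝ (Pmap d u) p (0, 1) =
      ((π / (2 * d) : ℝ) : ℂ) * hcoef d u (fun t => Real.sin (π * t / (2 * d))) p.1 *
        ((Real.cos (π * p.2 / (2 * d)) : ℝ) : ℂ) := by
  have h1 := (hcoef_hasDerivAt d u (fun t => Real.sin (π * t / (2 * d))) hu
    (by fun_prop) p.1).hasFDerivAt.comp p (hasFDerivAt_fst (𝕜 := ℝ) (p := p))
  have h2 := (sin_hasDerivAt d p.2).ofReal_comp.hasFDerivAt.comp p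
    (hasFDerivAt_snd (𝕜 := ℝ) (p := p))
  have h := h1.mul h2
  have h' : HasFDerivAt (Pmap d u) _ p := h
  refine ⟨h'.differentiableAt, ?_, ?_⟩
  · rw [h'.fderiv]; simp [mul_comm]
  · rw [h'.fderiv]; simp; ring

/-- Decomposition estimate: writing `u = Pu + (u − Pu)`, the shifted form of `u`
dominates the sum of the shifted forms of the two pieces with doubled potential. -/
theorem stmt_8 (d : ℝ) (hd : 0 < d) (V : ℝ × ℝ → ℝ)
    (hVmeas : Measurable V) (hVpos : ∀ p, 0 ≤ V p)
    (hVloc : ∀ B : Set (ℝ × ℝ), Bornology.IsBounded B → IntegrableOn V (B ∩ Strip d))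
    (u : ℝ × ℝ → ℂ) (hu : InH0 d u)
    (hVu : IntegrableOn (fun p => V p * ‖u p‖ ^ 2) (Strip d))
    (hVPu : IntegrableOn (fun p => V p * ‖Pmap d u p‖ ^ 2) (Strip d)) :
    qV d V 2 (Pmap d u) + qV d V 2 (fun p => u p - Pmap d u p) ≤ qV d V 1 u := by
  obtain ⟨hC, h0, -, hi, hix, hiy⟩ := hu
  have hc : Continuous u := hC.continuous
  have hcx : Continuous (fun p => fderiv ℝ u p (1, 0)) :=
    (hC.continuous_fderiv (by norm_num)).clm_apply continuous_const
  have hcy : Continuous (fun p => fderiv ℝ u p (0, 1)) :=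
    (hC.continuous_fderiv (by norm_num)).clm_apply continuous_const
  obtain ⟨a1, a2, a3⟩ := proj_lemma d hd u (fun t => Real.sin (π * t / (2 * d))) hc
    (by fun_prop) (sin_sq_int d hd) hi
  obtain ⟨b1, b2, b3⟩ := proj_lemma d hd _ (fun t => Real.sin (π * t / (2 * d))) hcx
    (by fun_prop) (sin_sq_int d hd) hix
  obtain ⟨c1, c2, c3⟩ := proj_lemma d hd _ (fun t => Real.cos (π * t / (2 * d))) hcy
    (by fun_prop) (cos_sq_int d hd) hiy
  simp only [hcoef_dy d hd u hC h0, ← (Pmap_hasFDerivAt d u hC _).2.2] at c1 c2 c3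
  simp only [← (Pmap_hasFDerivAt d u hC _).2.1] at b1 b2 b3
  have hP : ∀ p : ℝ × ℝ, hcoef d u (fun t => Real.sin (π * t / (2 * d))) p.1 *
      ((Real.sin (π * p.2 / (2 * d)) : ℝ) : ℂ) = Pmap d u p := fun p => rfl
  simp only [hP] at a1 a2 a3
  have hPc : Continuous (Pmap d u) :=
    continuous_iff_continuousAt.2 fun p => (Pmap_hasFDerivAt d u hC p).1.continuousAt
  have hVw := integrableOn_sub_sq V hVmeas hVpos u (Pmap d u) hc hPc hVu hVPu
  have hfw : ∀ p, fderiv ℝ (fun p => u p - Pmap d u p) p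
      = fderiv ℝ u p - fderiv ℝ (Pmap d u) p := fun p =>
    fderiv_fun_sub (hC.differentiable (by norm_num) p) (Pmap_hasFDerivAt d u hC p).1
  have key : ∫ p in Strip d, V p * ‖u p‖ ^ 2 ≤ 2 * (∫ p in Strip d, V p * ‖Pmap d u p‖ ^ 2)
      + 2 * ∫ p in Strip d, V p * ‖u p - Pmap d u p‖ ^ 2 := by
    rw [← integral_const_mul, ← integral_const_mul,
      ← integral_add (hVPu.const_mul 2) (hVw.const_mul 2)]
    refine integral_mono hVu ((hVPu.const_mul 2).add (hVw.const_mul 2)) fun p => ?_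
    have h := norm_add_le (Pmap d u p) (u p - Pmap d u p)
    rw [add_sub_cancel] at h
    have h3 : ‖u p‖ ^ 2 ≤ 2 * ‖Pmap d u p‖ ^ 2 + 2 * ‖u p - Pmap d u p‖ ^ 2 := by
      nlinarith [sq_nonneg (‖Pmap d u p‖ - ‖u p - Pmap d u p‖), norm_nonneg (u p),
        norm_nonneg (Pmap d u p), norm_nonneg (u p - Pmap d u p)]
    have := mul_le_mul_of_nonneg_left h3 (hVpos p)
    simp only
    linarith
  unfold qV
  simp only [hfw, sub_apply]
  rw [integral_three _ _ _ _ b1 c1 a1, integral_three _ _ _ _ b2 c2 a2,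
    integral_three _ _ _ _ hix hiy hi, a3, b3, c3]
  linarith
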